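/- arXiv:1510.04491 — 3 statements merged into one kernel-verified Lean document; each statement's English description precedes it below -/
import Mathlib

section
/- There exists a smooth vector field V on the circle 𝕋 = ℝ/ℤ (with the standard quotient metric) whose flow ψ is strongly chain recurrent (every point of 𝕋 is strongly chain recurrent for ψ) and which admits a continuous Lyapunov function h : 𝕋 → ℝ that is not a first integral. -/
open MeasureTheory

/-- A (continuous) flow on a metric space. -/
def IsFlow {X : Type*} [MetricSpace X] (ψ : ℝ → X → X) : Prop :=
  Continuous (fun p : ℝ × X => ψ p.1 p.2) ∧ (∀ x, ψ 0 x = x) ∧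
    ∀ t s x, ψ (t + s) x = ψ t (ψ s x)

/-- There is a strong `(ε,T)`-chain from `a` to `b`. -/
def HasStrongChain {X : Type*} [MetricSpace X] (ψ : ℝ → X → X) (ε T : ℝ) (a b : X) : Prop :=
  ∃ (n : ℕ) (x : Fin (n + 1) → X) (t : Fin n → ℝ), 0 < n ∧ (∀ i, T ≤ t i) ∧
    x 0 = a ∧ x (Fin.last n) = b ∧
    (∑ i : Fin n, dist (ψ (t i) (x i.castSucc)) (x i.succ)) < ε

/-- A strongly chain recurrent point. -/
def StronglyChainRecurrentPt {X : Type*} [MetricSpace X] (ψ : ℝ → X → X) (x : X) : Prop :=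
  ∀ ε > 0, ∀ T ≥ (0 : ℝ), HasStrongChain ψ ε T x x

/-- A chain recurrent point: for all `ε > 0`, `T ≥ 0` there is an `(ε,T)`-chain
from `x` to `x`, i.e. each jump `d(ψ_{t_i}(x_i), x_{i+1})` is `< ε`. -/
def ChainRecurrentPt {X : Type*} [MetricSpace X] (ψ : ℝ → X → X) (a : X) : Prop :=
  ∀ ε > 0, ∀ T ≥ (0 : ℝ), ∃ (n : ℕ) (x : Fin (n + 1) → X) (t : Fin n → ℝ),
    0 < n ∧ (∀ i, T ≤ t i) ∧ x 0 = a ∧ x (Fin.last n) = a ∧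
    ∀ i : Fin n, dist (ψ (t i) (x i.castSucc)) (x i.succ) < ε

/-- A Lyapunov function for the flow `ψ`. -/
def IsLyapunov {X : Type*} [MetricSpace X] (ψ : ℝ → X → X) (h : X → ℝ) : Prop :=
  ∀ t ≥ (0 : ℝ), ∀ x, h (ψ t x) ≤ h x

/-- A first integral for the flow `ψ`. -/
def IsFirstIntegral {X : Type*} [MetricSpace X] (ψ : ℝ → X → X) (h : X → ℝ) : Prop :=
  ∀ (t : ℝ) (x : X), h (ψ t x) = h x

/-- `ψ` is the flow on the circle `𝕋 = ℝ/ℤ` of the vector field `V(x) ∂/∂x`,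
expressed via a lifted flow `Ψ` on `ℝ` solving the lifted ODE. -/
def IsCircleFlowOf (V : UnitAddCircle → ℝ) (ψ : ℝ → UnitAddCircle → UnitAddCircle) : Prop :=
  ∃ Ψ : ℝ → ℝ → ℝ, (∀ x : ℝ, Ψ 0 x = x) ∧
    (∀ x t : ℝ, HasDerivAt (fun s => Ψ s x) (V ((Ψ t x : ℝ) : UnitAddCircle)) t) ∧
    ∀ t x : ℝ, ψ t ((x : ℝ) : UnitAddCircle) = ((Ψ t x : ℝ) : UnitAddCircle)

section

open Set Filter Topology
open scoped NNReal

/-! ### Flows on the line -/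

/-- `Ψ` is the global flow on the line of the autonomous vector field `v`. -/
structure IsLineFlow (v : ℝ → ℝ) (Ψ : ℝ → ℝ → ℝ) : Prop where
  zero : ∀ x, Ψ 0 x = x
  hasDerivAt : ∀ x t, HasDerivAt (fun s => Ψ s x) (v (Ψ t x)) t

/-- A bounded Lipschitz vector field on the line has a global flow. -/
theorem exists_isLineFlow {v : ℝ → ℝ} {K L : ℝ≥0} (hv : LipschitzWith K v)
    (hL : ∀ x, ‖v x‖ ≤ L) : ∃ Ψ, IsLineFlow v Ψ := by
  have local_sol (x : ℝ) (n : ℝ) : ∃ α : ℝ → ℝ, 0 < n → α 0 = x ∧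
      ∀ t ∈ Ioo (-n) n, HasDerivAt α (v (α t)) t := by
    by_cases hn : 0 < n
    · have hp : IsPicardLindelof (fun _ => v) (⟨0, by simp [hn.le]⟩ : Icc (-n) n) x
          (L * n.toNNReal) 0 L K := by
        refine .of_time_independent (fun y _ => hL y) hv.lipschitzOnWith ?_
        simp [hn.le]
      obtain ⟨α, h0, h⟩ := hp.exists_eq_forall_mem_Icc_hasDerivWithinAt₀
      exact ⟨α, fun _ => ⟨h0, fun t ht =>
        (h t (Ioo_subset_Icc_self ht)).hasDerivAt (Icc_mem_nhds ht.1 ht.2)⟩⟩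
    · exact ⟨fun _ => x, fun h => absurd h hn⟩
  choose α hα using local_sol
  have agree (x : ℝ) {m n : ℝ} (hm : 0 < m) (hmn : m ≤ n) : EqOn (α x m) (α x n) (Ioo (-m) m) :=
    ODE_solution_unique_of_mem_Ioo (v := fun _ => v) (s := fun _ => univ) (t₀ := 0)
      (fun _ _ => hv.lipschitzOnWith) (by simp [hm])
      (fun t ht => ⟨(hα x m hm).2 t ht, trivial⟩)
      (fun t ht => ⟨(hα x n (hm.trans_le hmn)).2 t
        ⟨by linarith [ht.1], by linarith [ht.2]⟩, trivial⟩)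
      (by rw [(hα x m hm).1, (hα x n (hm.trans_le hmn)).1])
  have key (x : ℝ) {t n : ℝ} (htn : |t| + 1 ≤ n) : α x (|t| + 1) t = α x n t :=
    agree x (by positivity) htn
      (abs_lt.1 (lt_add_one |t|))
  refine ⟨fun t x => α x (|t| + 1) t, fun x => (hα x _ (by positivity)).1, fun x t => ?_⟩
  have hmem : t ∈ Ioo (-(|t| + 2)) (|t| + 2) := abs_lt.1 (by linarith)
  have hd := (hα x (|t| + 2) (by positivity)).2 t hmem
  rw [key x (show |t| + 1 ≤ |t| + 2 by linarith)]
  refine hd.congr_of_eventuallyEq ?_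
  have : ∀ᶠ s in 𝓝 t, |s| < |t| + 1 :=
    continuous_abs.continuousAt.eventually_lt continuousAt_const (lt_add_one _)
  filter_upwards [this] with s hs
  exact key x (by linarith)

theorem dist_le_of_hasDerivAt_of_lipschitz {v f g : ℝ → ℝ} {K : ℝ≥0} (hv : LipschitzWith K v)
    (hf : ∀ t, HasDerivAt f (v (f t)) t) (hg : ∀ t, HasDerivAt g (v (g t)) t) {t : ℝ}
    (ht : 0 ≤ t) : dist (f t) (g t) ≤ dist (f 0) (g 0) * Real.exp (K * t) := by
  simpa using dist_le_of_trajectories_ODE (v := fun _ => v) (fun _ => hv)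
    (HasDerivAt.continuousOn fun s _ => hf s) (fun s _ => (hf s).hasDerivWithinAt)
    (HasDerivAt.continuousOn fun s _ => hg s) (fun s _ => (hg s).hasDerivWithinAt)
    le_rfl t ⟨ht, le_rfl⟩

namespace IsLineFlow

variable {v : ℝ → ℝ} {Ψ : ℝ → ℝ → ℝ} {K : ℝ≥0}

theorem continuous_time (h : IsLineFlow v Ψ) (x : ℝ) : Continuous fun t => Ψ t x :=
  continuous_iff_continuousAt.2 fun t => (h.hasDerivAt x t).continuousAt

theorem eq_of_hasDerivAt (h : IsLineFlow v Ψ) (hv : LipschitzWith K v) {f : ℝ → ℝ}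
    (hf : ∀ t, HasDerivAt f (v (f t)) t) {t₀ x : ℝ} (h0 : f t₀ = Ψ t₀ x) (t : ℝ) :
    f t = Ψ t x :=
  congrFun (ODE_solution_unique_univ (v := fun _ => v) (s := fun _ => univ) (t₀ := t₀)
    (fun _ => hv.lipschitzOnWith) (fun t => ⟨hf t, trivial⟩)
    (fun t => ⟨h.hasDerivAt x t, trivial⟩) h0) t

theorem add (h : IsLineFlow v Ψ) (hv : LipschitzWith K v) (t s x : ℝ) :
    Ψ (t + s) x = Ψ t (Ψ s x) :=
  h.eq_of_hasDerivAt hv (f := fun t => Ψ (t + s) x) (t₀ := 0)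
    (fun t => (h.hasDerivAt x (t + s)).comp_add_const t s) (by simp [h.zero]) t

theorem add_one (h : IsLineFlow v Ψ) (hv : LipschitzWith K v) (hp : Function.Periodic v 1)
    (t x : ℝ) : Ψ t (x + 1) = Ψ t x + 1 := by
  refine (h.eq_of_hasDerivAt hv (f := fun t => Ψ t x + 1) (t₀ := 0) (fun t => ?_)
    (by simp [h.zero]) t).symm
  rw [hp]
  exact (h.hasDerivAt x t).add_const 1

theorem eq_of_apply_eq_zero (h : IsLineFlow v Ψ) (hv : LipschitzWith K v) {x t : ℝ}
    (hx : v (Ψ t x) = 0) (s : ℝ) : Ψ s x = Ψ t x := by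
  refine (h.eq_of_hasDerivAt hv (f := fun _ => Ψ t x) (t₀ := t) (fun s => ?_) rfl s).symm
  rw [hx]
  exact hasDerivAt_const _ _

theorem apply_of_zero (h : IsLineFlow v Ψ) (hv : LipschitzWith K v) {x : ℝ}
    (hx : v x = 0) (s : ℝ) : Ψ s x = x := by
  have := h.eq_of_apply_eq_zero hv (x := x) (t := 0) (by rwa [h.zero]) s
  rwa [h.zero] at this

theorem dist_le (h : IsLineFlow v Ψ) (hv : LipschitzWith K v) (t x y : ℝ) :
    dist (Ψ t x) (Ψ t y) ≤ dist x y * Real.exp (K * |t|) := by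
  rcases le_total 0 t with ht | ht
  · simpa [h.zero, abs_of_nonneg ht] using
      dist_le_of_hasDerivAt_of_lipschitz hv (h.hasDerivAt x) (h.hasDerivAt y) ht
  · have hneg (z s : ℝ) : HasDerivAt (fun s => Ψ (-s) z) (-v (Ψ (-s) z)) s := by
      have := (h.hasDerivAt z (-s)).scomp s (hasDerivAt_neg s)
      rwa [neg_one_smul] at this
    simpa [h.zero, abs_of_nonpos ht] using
      dist_le_of_hasDerivAt_of_lipschitz (v := fun x => -v x) hv.neg
        (hneg x) (hneg y) (neg_nonneg.2 ht)

theorem continuous (h : IsLineFlow v Ψ) (hv : LipschitzWith K v) :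
    Continuous fun p : ℝ × ℝ => Ψ p.1 p.2 := by
  refine continuous_iff_continuousAt.2 fun ⟨t, x⟩ => ?_
  refine tendsto_iff_dist_tendsto_zero.2 ?_
  have hc : Continuous fun p : ℝ × ℝ =>
      dist p.2 x * Real.exp (K * |p.1|) + dist (Ψ p.1 x) (Ψ t x) := by
    have := h.continuous_time x
    fun_prop
  refine squeeze_zero (fun _ => dist_nonneg) (fun p => (dist_triangle _ (Ψ p.1 x) _).trans
    (add_le_add_left (h.dist_le hv _ _ _) _)) ?_
  simpa using hc.tendsto (t, x)

theorem monotone_time (h : IsLineFlow v Ψ) (hn : ∀ x, 0 ≤ v x) (x : ℝ) :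
    Monotone fun t => Ψ t x :=
  monotone_of_hasDerivAt_nonneg (h.hasDerivAt x) fun _ => hn _

theorem le_of_le_zero (h : IsLineFlow v Ψ) (hv : LipschitzWith K v) {x k t : ℝ}
    (hk : v k = 0) (hx : x ≤ k) (ht : 0 ≤ t) : Ψ t x ≤ k := by
  by_contra! hlt
  obtain ⟨s, -, hs⟩ := intermediate_value_Icc ht (h.continuous_time x).continuousOn
    ⟨(h.zero x).le.trans hx, hlt.le⟩
  have := h.eq_of_apply_eq_zero hv (x := x) (t := s) (by simpa only [← hs] using hk) t
  exact hlt.ne' (this.trans hs)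

theorem zero_le_of_le (h : IsLineFlow v Ψ) (hv : LipschitzWith K v) {x k t : ℝ}
    (hk : v k = 0) (hx : k ≤ x) (ht : t ≤ 0) : k ≤ Ψ t x := by
  by_contra! hlt
  have := h.le_of_le_zero hv hk hlt.le (neg_nonneg.2 ht)
  rw [← h.add hv, neg_add_cancel, h.zero] at this
  obtain rfl := le_antisymm this hx
  exact hlt.ne (h.apply_of_zero hv hk t)

theorem lt_apply (h : IsLineFlow v Ψ) (hv : LipschitzWith K v) (hn : ∀ x, 0 ≤ v x)
    {x t : ℝ} (hx : v x ≠ 0) (ht : 0 < t) : x < Ψ t x := by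
  refine lt_of_le_of_ne ?_ fun he => hx ?_
  · simpa [h.zero] using h.monotone_time hn x ht.le
  · obtain ⟨c, -, hc⟩ := exists_hasDerivAt_eq_slope (fun s => Ψ s x) (fun s => v (Ψ s x)) ht
      (h.continuous_time x).continuousOn fun s _ => h.hasDerivAt x s
    simp only [h.zero, ← he, sub_self, zero_div] at hc
    have := h.eq_of_apply_eq_zero hv hc 0
    rwa [← this, h.zero] at hc

/-- Backward orbits above a zero of the field converge to a zero of the field. -/
theorem exists_tendsto_atBot (h : IsLineFlow v Ψ) (hv : LipschitzWith K v)
    (hn : ∀ x, 0 ≤ v x) {k x : ℝ} (hk : v k = 0) (hx : k ≤ x) :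
    ∃ a, k ≤ a ∧ v a = 0 ∧ Tendsto (fun t => Ψ t x) atBot (𝓝 a) := by
  have hmono : Monotone fun t => Ψ t x := h.monotone_time hn x
  have hlow : ∀ t, k ≤ Ψ t x := fun t => (h.zero_le_of_le hv hk hx (min_le_right t 0)).trans
    (hmono (min_le_left t 0))
  have hlim := tendsto_atBot_ciInf hmono ⟨k, by rintro _ ⟨t, rfl⟩; exact hlow t⟩
  refine ⟨_, le_ciInf hlow, ?_, hlim⟩
  set a := ⨅ t, Ψ t x
  have hfix (s : ℝ) : Ψ s a = a := by
    have h1 : Tendsto (fun t => Ψ s (Ψ t x)) atBot (𝓝 (Ψ s a)) :=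
      (((h.continuous hv).comp (Continuous.prodMk_right s)).tendsto a).comp hlim
    have h2 : Tendsto (fun t => Ψ (s + t) x) atBot (𝓝 a) :=
      hlim.comp (tendsto_atBot_add_const_left _ s tendsto_id)
    simp only [h.add hv] at h2
    exact tendsto_nhds_unique h1 h2
  have hd := h.hasDerivAt a 0
  simp only [hfix] at hd
  exact hd.unique (hasDerivAt_const _ _)

/-- A continuous function that is locally constant off the zeros of the field is constant along
orbits. -/
theorem apply_eq_of_locallyConst (h : IsLineFlow v Ψ) (hv : LipschitzWith K v)
    {c : ℝ → ℝ} (hc : ∀ x, v x ≠ 0 → ∀ᶠ y in 𝓝 x, c y = c x) (t x : ℝ) :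
    c (Ψ t x) = c x := by
  have hloc : IsLocallyConstant fun s => c (Ψ s x) := by
    refine (IsLocallyConstant.iff_eventually_eq _).2 fun s => ?_
    by_cases hs : v (Ψ s x) = 0
    · exact .of_forall fun r => by rw [h.eq_of_apply_eq_zero hv hs r]
    · exact (h.continuous_time x).continuousAt.eventually (hc _ hs)
  simpa [h.zero] using hloc.apply_eq_of_isPreconnected isPreconnected_univ
    (mem_univ t) (mem_univ 0)

end IsLineFlow

/-! ### The Cantor function -/

/-- The Picard iterates `c ↦ (c (3 * x) + c (3 * x - 2)) / 2` converging to the Cantor function,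
extended by constants outside the unit interval. -/
noncomputable def cantorIter : ℕ → ℝ → ℝ
  | 0, x => max 0 (min x 1)
  | n + 1, x => (cantorIter n (3 * x) + cantorIter n (3 * x - 2)) / 2

theorem continuous_cantorIter (n : ℕ) : Continuous (cantorIter n) := by
  induction n with
  | zero => exact continuous_const.max (continuous_id.min continuous_const)
  | succ n ih =>
    exact ((ih.comp (by fun_prop : Continuous fun x : ℝ => 3 * x)).add
      (ih.comp (by fun_prop : Continuous fun x : ℝ => 3 * x - 2))).div_const 2

theorem cantorIter_of_nonpos (n : ℕ) {x : ℝ} (hx : x ≤ 0) : cantorIter n x = 0 := by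
  induction n generalizing x with
  | zero => simp [cantorIter, hx]
  | succ n ih => rw [cantorIter, ih (by linarith), ih (by linarith)]; simp

theorem cantorIter_of_one_le (n : ℕ) {x : ℝ} (hx : 1 ≤ x) : cantorIter n x = 1 := by
  induction n generalizing x with
  | zero => simp [cantorIter, hx]
  | succ n ih => rw [cantorIter, ih (by linarith), ih (by linarith)]; norm_num

theorem dist_cantorIter_succ_le (n : ℕ) (x : ℝ) :
    dist (cantorIter n x) (cantorIter (n + 1) x) ≤ 1 / 2 / 2 ^ n := by
  induction n generalizing x with
  | zero =>
    simp only [cantorIter, Real.dist_eq, abs_le]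
    grind
  | succ n ih =>
    rw [cantorIter, cantorIter, Real.dist_eq]
    have h1 := ih (3 * x)
    have h2 := ih (3 * x - 2)
    rw [Real.dist_eq] at h1 h2
    rw [pow_succ]
    have e : (1 : ℝ) / 2 / (2 ^ n * 2) = 1 / 2 / 2 ^ n / 2 := by field_simp
    rw [e]
    generalize (1 : ℝ) / 2 / 2 ^ n = q at *
    rcases le_total (3 * x) 1 with h | h
    · have h3 : 3 * x - 2 ≤ 0 := by linarith
      simp only [cantorIter_of_nonpos _ h3]
      rw [abs_le] at *
      constructor <;> linarith
    · simp only [cantorIter_of_one_le _ h]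
      rw [abs_le] at *
      constructor <;> linarith

/-- The Cantor function: continuous, and locally constant off the Cantor set. -/
theorem exists_cantor_function : ∃ c : ℝ → ℝ, Continuous c ∧ c 0 = 0 ∧ c 1 = 1 ∧
    ∀ x ∉ cantorSet, ∀ᶠ y in 𝓝 x, c y = c x := by
  have hlim (x : ℝ) : ∃ l, Tendsto (fun n => cantorIter n x) atTop (𝓝 l) :=
    cauchySeq_tendsto_of_complete (cauchySeq_of_le_geometric_two fun n =>
      dist_cantorIter_succ_le n x)
  choose c hc using hlim
  have hle (n : ℕ) (x : ℝ) : dist (cantorIter n x) (c x) ≤ 1 / 2 ^ n :=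
    dist_le_of_le_geometric_two_of_tendsto (fun n => dist_cantorIter_succ_le n x) (hc x) n
  have hnonpos {x : ℝ} (hx : x ≤ 0) : c x = 0 :=
    tendsto_nhds_unique (hc x) (by simp [cantorIter_of_nonpos _ hx])
  have hone {x : ℝ} (hx : 1 ≤ x) : c x = 1 :=
    tendsto_nhds_unique (hc x) (by simp [cantorIter_of_one_le _ hx])
  have hself (x : ℝ) : c x = (c (3 * x) + c (3 * x - 2)) / 2 :=
    tendsto_nhds_unique ((hc x).comp (tendsto_add_atTop_nat 1))
      (((hc (3 * x)).add (hc (3 * x - 2))).div_const 2)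
  have hpre (n : ℕ) : ∀ x ∉ preCantorSet n, ∀ᶠ y in 𝓝 x, c y = c x := by
    induction n with
    | zero =>
      intro x hx
      rw [preCantorSet_zero, mem_Icc, not_and_or, not_le, not_le] at hx
      rcases hx with hx | hx
      · filter_upwards [Iio_mem_nhds hx] with y hy
        rw [hnonpos hx.le, hnonpos (le_of_lt hy)]
      · filter_upwards [Ioi_mem_nhds hx] with y hy
        rw [hone hx.le, hone (le_of_lt hy)]
    | succ n ih =>
      intro x hx
      rw [preCantorSet_succ, mem_union, not_or] at hx
      have h1 : 3 * x ∉ preCantorSet n := fun h => hx.1 ⟨_, h, by ring⟩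
      have h2 : 3 * x - 2 ∉ preCantorSet n := fun h => hx.2 ⟨_, h, by ring⟩
      have c1 : ContinuousAt (fun y : ℝ => 3 * y) x := by fun_prop
      have c2 : ContinuousAt (fun y : ℝ => 3 * y - 2) x := by fun_prop
      filter_upwards [c1.eventually (ih _ h1), c2.eventually (ih _ h2)] with y e1 e2
      rw [hself y, hself x, e1, e2]
  refine ⟨c, ?_, hnonpos le_rfl, hone le_rfl, fun x hx => ?_⟩
  · have hu : TendstoUniformly cantorIter c atTop := by
      refine Metric.tendstoUniformly_iff.2 fun ε hε => ?_
      have : Tendsto (fun n : ℕ => (1 : ℝ) / 2 ^ n) atTop (𝓝 0) := by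
        simpa using tendsto_pow_atTop_nhds_zero_of_lt_one (r := (1 / 2 : ℝ)) (by norm_num)
          (by norm_num)
      filter_upwards [this.eventually_lt_const hε] with n hn x
      rw [dist_comm]
      exact (hle n x).trans_lt hn
    exact hu.continuous (Frequently.of_forall continuous_cantorIter)
  · obtain ⟨n, hn⟩ : ∃ n, x ∉ preCantorSet n := by simpa [cantorSet] using hx
    exact hpre n x hn

open scoped Pointwise in
theorem volume_cantorSet : volume cantorSet = 0 := by
  have hfin : volume cantorSet ≠ ⊤ := isCompact_cantorSet.measure_lt_top.ne
  have h1 : volume ((· / 3) '' cantorSet) = ENNReal.ofReal (1 / 3) * volume cantorSet := by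
    have : (· / 3) '' cantorSet = (1 / 3 : ℝ) • cantorSet := by
      ext x; simp [Set.mem_smul_set, div_eq_inv_mul]
    rw [this, Measure.addHaar_smul]
    simp [abs_of_pos]
  have h2 : volume ((fun x : ℝ => (2 + x) / 3) '' cantorSet) =
      ENNReal.ofReal (1 / 3) * volume cantorSet := by
    have : (fun x : ℝ => (2 + x) / 3) '' cantorSet =
        (2 / 3 + ·) '' ((· / 3) '' cantorSet) := by
      rw [image_image]; simp only [add_div]
    rw [this, image_add_left, measure_preimage_add, h1]
  have h := measure_union_le (μ := volume) ((· / 3) '' cantorSet)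
    ((fun x : ℝ => (2 + x) / 3) '' cantorSet)
  rw [← cantorSet_eq_union_halves, h1, h2] at h
  have h' := ENNReal.toReal_mono (by finiteness) h
  rw [ENNReal.toReal_add (by finiteness) (by finiteness), ENNReal.toReal_mul,
    ENNReal.toReal_ofReal (by norm_num)] at h'
  have h0 : (volume cantorSet).toReal = 0 :=
    le_antisymm (by linarith) ENNReal.toReal_nonneg
  exact (ENNReal.toReal_eq_zero_iff _).1 h0 |>.resolve_right hfin

/-- A continuous singular function on the line commuting with the unit translation. -/
theorem exists_periodic_singular_function : ∃ h : ℝ → ℝ, Continuous h ∧ Function.Periodic h 1 ∧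
    volume {x | ¬ ∀ᶠ y in 𝓝 x, h y + y = h x + x} = 0 := by
  obtain ⟨c, hc, h0, h1, hloc⟩ := exists_cantor_function
  refine ⟨fun x => c (Int.fract x) - Int.fract x, ?_, fun x => by simp, ?_⟩
  · exact (hc.sub continuous_id).continuousOn.comp_fract'' (by simp [h0, h1])
  · refine measure_mono_null (t := ⋃ n : ℤ, (· + (n : ℝ)) ⁻¹' cantorSet) (fun x hx => ?_)
      (measure_iUnion_null fun n => by rw [measure_preimage_add_right, volume_cantorSet])
    contrapose hx
    simp only [mem_iUnion, mem_preimage, not_exists] at hx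
    have hx' : Int.fract x ∉ cantorSet := by
      simpa [Int.fract, sub_eq_add_neg] using hx (-⌊x⌋)
    have hpos : (⌊x⌋ : ℝ) < x := lt_of_le_of_ne (Int.floor_le x) fun h =>
      hx' (by rw [Int.fract, h, sub_self]; exact zero_mem_cantorSet)
    have hsub : ContinuousAt (fun y : ℝ => y - ⌊x⌋) x := by fun_prop
    simp only [mem_ofPred_eq, not_not]
    filter_upwards [Ioo_mem_nhds hpos (Int.lt_floor_add_one x),
      hsub.eventually (hloc (x - ⌊x⌋) hx')] with y hy hcy
    have hfl : ⌊y⌋ = ⌊x⌋ := Int.floor_eq_iff.2 ⟨hy.1.le, hy.2⟩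
    simp only [Int.fract, hfl, hcy]
    ring

/-! ### Strong chains -/

namespace HasStrongChain

variable {X Y : Type*} [MetricSpace X] [MetricSpace Y] {ψ : ℝ → X → X} {ε T : ℝ} {a b c : X}

theorem mono {ε' T' : ℝ} (h : HasStrongChain ψ ε T a b) (hε : ε ≤ ε') (hT : T' ≤ T) :
    HasStrongChain ψ ε' T' a b := by
  obtain ⟨n, x, t, hn, ht, h0, hl, hs⟩ := h
  exact ⟨n, x, t, hn, fun i => hT.trans (ht i), h0, hl, hs.trans_le hε⟩

theorem single {t : ℝ} (ht : T ≤ t) (h : dist (ψ t a) b < ε) : HasStrongChain ψ ε T a b :=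
  ⟨1, ![a, b], ![t], one_pos, by simpa, rfl, rfl, by simpa⟩

theorem snoc (h : HasStrongChain ψ ε T a b) {t : ℝ} (ht : T ≤ t) :
    HasStrongChain ψ (ε + dist (ψ t b) c) T a c := by
  obtain ⟨n, x, s, hn, hs, h0, hl, hsum⟩ := h
  refine ⟨n + 1, Fin.snoc x c, Fin.snoc s t, n.succ_pos, fun i => ?_, ?_, by simp, ?_⟩
  · induction i using Fin.lastCases with
    | last => simpa
    | cast i => simpa using hs i
  · rw [← Fin.castSucc_zero, Fin.snoc_castSucc, h0]
  · rw [Fin.sum_univ_castSucc]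
    have e (i : Fin n) : (Fin.snoc x c : Fin (n + 2) → X) i.castSucc.succ = x i.succ := by
      rw [Fin.succ_castSucc, Fin.snoc_castSucc]
    simp only [Fin.snoc_castSucc, Fin.snoc_last, Fin.succ_last, e, hl]
    gcongr

theorem map {φ : ℝ → Y → Y} {π : X → Y} (hπ : ∀ x y, dist (π x) (π y) ≤ dist x y)
    (hψ : ∀ t x, φ t (π x) = π (ψ t x)) (h : HasStrongChain ψ ε T a b) :
    HasStrongChain φ ε T (π a) (π b) := by
  obtain ⟨n, x, t, hn, ht, h0, hl, hs⟩ := h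
  refine ⟨n, π ∘ x, t, hn, ht, by simp [h0], by simp [hl], hs.trans_le' ?_⟩
  exact Finset.sum_le_sum fun i _ => by simpa only [Function.comp, hψ] using hπ _ _

end HasStrongChain

namespace IsLineFlow

variable {v : ℝ → ℝ} {Ψ : ℝ → ℝ → ℝ} {K : ℝ≥0}

/-- If the zeros of a nonnegative field form a null set, every zero can be reached from the left
by strong chains. -/
theorem hasStrongChain_of_le (h : IsLineFlow v Ψ) (hv : LipschitzWith K v) (hn : ∀ x, 0 ≤ v x)
    (hnull : volume {x | v x = 0} = 0) {x k ε T : ℝ} (hk : v k = 0) (hxk : x ≤ k) (hε : 0 < ε)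
    (hT : 0 < T) : HasStrongChain Ψ ε T x k := by
  obtain ⟨U, hZU, hU, hUε⟩ := Set.exists_isOpen_lt_of_lt {x | v x = 0} (ENNReal.ofReal ε)
    (by rw [hnull]; exact ENNReal.ofReal_pos.2 hε)
  have hUfin : volume U ≠ ⊤ := hUε.ne_top
  set m : ℝ → ℝ := fun y => volume.real (U ∩ Ioc x y) with hm
  have le_flow (y : ℝ) : y ≤ Ψ T y := by simpa [h.zero] using h.monotone_time hn y hT.le
  set R : Set ℝ := {y | x ≤ y ∧ y ≤ k ∧ ∀ η > 0, HasStrongChain Ψ (m y + η) T x y}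
  have start : Ψ T x ∈ R := ⟨le_flow x, h.le_of_le_zero hv hk hxk hT.le, fun η hη =>
    .single le_rfl (by rw [dist_self]; positivity)⟩
  have jump {y z : ℝ} (hy : y ∈ R) (hyz : Ψ T y ≤ z) (hzk : z ≤ k) (hzU : Ioc (Ψ T y) z ⊆ U) :
      z ∈ R := by
    refine ⟨hy.1.trans ((le_flow y).trans hyz), hzk, fun η hη => ?_⟩
    refine ((hy.2.2 η hη).snoc le_rfl).mono ?_ le_rfl
    have hdisj : Disjoint (U ∩ Ioc x y) (Ioc (Ψ T y) z) :=
      Set.disjoint_left.2 fun u hu hu' => by linarith [hu.2.2, hu'.1, le_flow y]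
    have hsub : U ∩ Ioc x y ∪ Ioc (Ψ T y) z ⊆ U ∩ Ioc x z := by
      rintro u (hu | hu)
      · exact ⟨hu.1, hu.2.1, by linarith [hu.2.2, le_flow y]⟩
      · exact ⟨hzU hu, by linarith [hu.1, le_flow y, hy.1], hu.2⟩
    have hle := measureReal_mono (μ := volume) hsub
      (measure_ne_top_of_subset inter_subset_left hUfin)
    rw [measureReal_union hdisj measurableSet_Ioc
      (measure_ne_top_of_subset inter_subset_left hUfin) measure_Ioc_lt_top.ne,
      Real.volume_real_Ioc_of_le hyz] at hle
    rw [dist_comm, Real.dist_eq, abs_of_nonneg (sub_nonneg.2 hyz)]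
    simp only [hm]
    linarith
  have hbdd : BddAbove R := ⟨k, fun y hy => hy.2.1⟩
  have flow_mem {y : ℝ} (hy : y ∈ R) : Ψ T y ∈ R :=
    jump hy le_rfl (h.le_of_le_zero hv hk hy.2.1 hT.le) (by simp)
  set s := sSup R
  have hsk : s ≤ k := csSup_le ⟨_, start⟩ fun y hy => hy.2.1
  have hs : v s = 0 := by
    by_contra hs
    have hcont : ContinuousAt (Ψ T) s :=
      ((h.continuous hv).comp (Continuous.prodMk_right T)).continuousAt
    obtain ⟨δ, hδ, hball⟩ := Metric.eventually_nhds_iff.1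
      (hcont.eventually_const_lt (h.lt_apply hv hn hs hT))
    obtain ⟨y, hy, hsy⟩ := exists_lt_of_lt_csSup ⟨_, start⟩ (sub_lt_self s hδ)
    have hys : y ≤ s := le_csSup hbdd hy
    have : s < Ψ T y := hball (by rw [Real.dist_eq, abs_lt]; constructor <;> linarith)
    exact this.not_ge (le_csSup hbdd (flow_mem hy))
  obtain ⟨δ, hδ, hball⟩ := Metric.isOpen_iff.1 hU s (hZU hs)
  obtain ⟨y, hy, hsy⟩ := exists_lt_of_lt_csSup ⟨_, start⟩ (sub_lt_self s hδ)
  have hws : Ψ T y ≤ s := le_csSup hbdd (flow_mem hy)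
  have hz : min (s + δ / 2) k ∈ R := by
    refine jump hy (le_min (by linarith) (hws.trans hsk)) (min_le_right _ _) fun u hu => hball ?_
    rw [Metric.mem_ball, Real.dist_eq, abs_lt]
    constructor <;> linarith [hu.1, hu.2.trans (min_le_left _ _), le_flow y]
  have hkR : k ∈ R := by
    rcases min_le_iff.1 (le_csSup hbdd hz) with h1 | h1
    · linarith
    · rwa [min_eq_right (by linarith)] at hz
  have hmk : m k < ε :=
    (measureReal_mono inter_subset_left hUfin).trans_lt (ENNReal.toReal_lt_of_lt_ofReal hUε)
  simpa using hkR.2.2 (ε - m k) (sub_pos.2 hmk)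

theorem hasStrongChain_add_one (h : IsLineFlow v Ψ) (hv : LipschitzWith K v)
    (hp : Function.Periodic v 1) (hn : ∀ x, 0 ≤ v x) (hnull : volume {x | v x = 0} = 0)
    (hne : ∃ k, v k = 0) (x : ℝ) {ε T : ℝ} (hε : 0 < ε) (hT : 0 < T) :
    HasStrongChain Ψ ε T x (x + 1) := by
  obtain ⟨k, hk⟩ := hne
  have hk' : v (k + ⌊x - k⌋) = 0 := by simpa [hk] using hp.int_mul ⌊x - k⌋ k
  obtain ⟨a, hka, ha, hlim⟩ := h.exists_tendsto_atBot (x := x) hv hn hk'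
    (by linarith [Int.floor_le (x - k)])
  have ha1 : v (a + 1) = 0 := by rw [hp, ha]
  have hxa : x ≤ a + 1 := by linarith [Int.lt_floor_add_one (x - k)]
  obtain ⟨t, hta, htT⟩ := ((Metric.tendsto_nhds.1 hlim (ε / 2) (half_pos hε)).and
    (eventually_le_atBot (-T))).exists
  refine (((h.hasStrongChain_of_le hv hn hnull ha1 hxa (half_pos hε) hT).snoc (c := Ψ t x + 1)
    le_rfl).snoc (c := x + 1) (le_neg_of_le_neg htT)).mono ?_ le_rfl
  rw [h.apply_of_zero hv ha1, h.add_one hv hp, ← h.add hv, neg_add_cancel, h.zero, dist_self,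
    dist_add_right, dist_comm]
  linarith

end IsLineFlow

/-! ### Vector fields on the circle -/

/-- A closed subset of the line invariant under the unit translation is the zero set of a smooth
nonnegative function on the circle. -/
theorem exists_contDiff_zero_set_eq {S : Set ℝ} (hS : IsClosed S)
    (hp : ∀ x, x + 1 ∈ S ↔ x ∈ S) : ∃ V : UnitAddCircle → ℝ,
      ContDiff ℝ (⊤ : ℕ∞) (fun x : ℝ => V x) ∧ (∀ p, 0 ≤ V p) ∧ ∀ x : ℝ, V x = 0 ↔ x ∈ S := by
  have hpre : ((↑) : ℝ → UnitAddCircle) ⁻¹' ((↑) '' S) = S := by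
    refine (subset_preimage_image _ _).antisymm' fun x hx => ?_
    obtain ⟨y, hy, hyx⟩ := hx
    have hper : Function.Periodic (· ∈ S) 1 := fun z => propext (hp z)
    obtain ⟨n, hn⟩ := (QuotientAddGroup.eq_iff_sub_mem.1 hyx)
    have hxy : x = y - n := by simp at hn; linarith
    have := hper.sub_int_mul_eq (x := y) n
    simp only [mul_one] at this
    rw [hxy, this]
    exact hy
  have hclosed : IsClosed (((↑) : ℝ → UnitAddCircle) '' S) := by
    rw [← (QuotientAddGroup.isQuotientMap_mk _).isClosed_preimage]
    exact hpre.symm ▸ hS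
  set e : UnitAddCircle → ℂ := fun p => AddCircle.toCircle p with he
  have hecont : Continuous e := by
    have := AddCircle.continuous_toCircle (T := 1)
    fun_prop
  have heinj : Function.Injective e :=
    Subtype.val_injective.comp (AddCircle.injective_toCircle one_ne_zero)
  obtain ⟨g, hg, hgd, hgr⟩ := (hclosed.isCompact.image hecont).isClosed.isOpen_compl
    |>.exists_contDiff_support_eq (n := ⊤)
  refine ⟨g ∘ e, ?_, fun p => (hgr (mem_range_self _)).1, fun x => ?_⟩
  · have : (fun x : ℝ => (g ∘ e) (x : UnitAddCircle)) =
        fun x : ℝ => g (Complex.exp (2 * Real.pi * x * Complex.I)) := by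
      ext x
      simp [he, AddCircle.toCircle_apply_mk, Circle.coe_exp]
    rw [this]
    have := Complex.ofRealCLM.contDiff (n := (⊤ : ℕ∞))
    exact hgd.comp (Complex.contDiff_exp.comp
      ((contDiff_const.mul this).mul contDiff_const))
  · rw [← Function.notMem_support (f := g ∘ e), Function.support_comp_eq_preimage, hg,
      preimage_compl, preimage_image_eq _ heinj, mem_compl_iff, not_not]
    exact Set.ext_iff.1 hpre x

theorem exists_bound_of_continuous_of_periodic {f : ℝ → ℝ} (hf : Continuous f)
    (hp : Function.Periodic f 1) : ∃ C : ℝ≥0, ∀ x, ‖f x‖ ≤ C := by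
  obtain ⟨C, hC⟩ := (hp.compact_of_continuous one_ne_zero hf).isBounded.exists_norm_le
  exact ⟨C.toNNReal, fun x => (hC _ (mem_range_self x)).trans (Real.le_coe_toNNReal C)⟩

theorem exists_lipschitzWith_of_contDiff_of_periodic {f : ℝ → ℝ} (hf : ContDiff ℝ 1 f)
    (hp : Function.Periodic f 1) : ∃ K, LipschitzWith K f := by
  obtain ⟨K, hK⟩ := exists_bound_of_continuous_of_periodic hf.continuous_deriv_one
    (fun x => by rw [← deriv_comp_add_const, hp.funext])
  exact ⟨K, lipschitzWith_of_nnnorm_deriv_le (hf.differentiable one_ne_zero) hK⟩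

theorem unitAddCircle_dist_coe_le (x y : ℝ) : dist (x : UnitAddCircle) y ≤ dist x y := by
  rw [dist_eq_norm, dist_eq_norm, ← AddCircle.coe_sub]
  exact QuotientAddGroup.norm_mk_le_norm

/-- The flow on the circle induced by a flow on the line commuting with the unit translation. -/
theorem IsLineFlow.exists_circle_flow {V : UnitAddCircle → ℝ} {Ψ : ℝ → ℝ → ℝ} {K : ℝ≥0}
    (h : IsLineFlow (fun x : ℝ => V x) Ψ) (hv : LipschitzWith K fun x : ℝ => V x) :
    ∃ ψ : ℝ → UnitAddCircle → UnitAddCircle, IsFlow ψ ∧ IsCircleFlowOf V ψ ∧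
      ∀ t x : ℝ, ψ t (x : UnitAddCircle) = (Ψ t x : ℝ) := by
  have hp : Function.Periodic (fun x : ℝ => V x) 1 := fun x => by simp
  have hper (t : ℝ) : Function.Periodic (fun x => (Ψ t x : UnitAddCircle)) 1 := fun x => by
    simp [h.add_one hv hp]
  set ψ : ℝ → UnitAddCircle → UnitAddCircle := fun t => (hper t).lift
  have hψ (t x : ℝ) : ψ t (x : UnitAddCircle) = (Ψ t x : ℝ) := (hper t).lift_coe x
  refine ⟨ψ, ⟨?_, fun p => ?_, fun t s p => ?_⟩, ⟨Ψ, h.zero, h.hasDerivAt, hψ⟩, hψ⟩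
  · have hq : IsOpenQuotientMap (Prod.map id ((↑) : ℝ → UnitAddCircle) : ℝ × ℝ → _) :=
      IsOpenQuotientMap.id.prodMap QuotientAddGroup.isOpenQuotientMap_mk
    rw [hq.isQuotientMap.continuous_iff]
    exact (AddCircle.continuous_mk' 1).comp (h.continuous hv) |>.congr
      fun p => (hψ p.1 p.2).symm
  · induction p using QuotientAddGroup.induction_on with
    | H x => exact (hψ 0 x).trans (by rw [h.zero])
  · induction p using QuotientAddGroup.induction_on with
    | H x => exact (hψ _ x).trans (by rw [h.add hv, ← hψ, ← hψ])

end

open Set Filter Topology in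
theorem exists_SCR_flow_with_nontrivial_continuous_lyapunov :
    ∃ (V : UnitAddCircle → ℝ) (ψ : ℝ → UnitAddCircle → UnitAddCircle),
      ContDiff ℝ (⊤ : ℕ∞) (fun x : ℝ => V x) ∧ IsFlow ψ ∧ IsCircleFlowOf V ψ ∧
      (∀ p : UnitAddCircle, StronglyChainRecurrentPt ψ p) ∧
      ∃ h : UnitAddCircle → ℝ, Continuous h ∧
        IsLyapunov ψ h ∧ ¬ IsFirstIntegral ψ h := by
  obtain ⟨h, hcont, hper, hnull⟩ := exists_periodic_singular_function
  set S : Set ℝ := {x | ¬ ∀ᶠ y in 𝓝 x, h y + y = h x + x}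
  have hSmem (x : ℝ) : x ∈ S ↔ ¬ ∀ᶠ y in 𝓝 x, h y + y = h x + x := Iff.rfl
  have hSclosed : IsClosed S := by
    refine ⟨isOpen_iff_eventually.2 fun x hx => ?_⟩
    rw [mem_compl_iff, hSmem, not_not] at hx
    filter_upwards [hx.eventually_nhds, hx] with y hy hyx
    rw [mem_compl_iff, hSmem, not_not]
    filter_upwards [hy] with z hz
    rw [hz, hyx]
  have hSper (x : ℝ) : x + 1 ∈ S ↔ x ∈ S := by
    rw [hSmem, hSmem, not_iff_not, ← map_add_right_nhds, eventually_map]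
    simp only [hper _, ← add_assoc, add_left_inj]
  have hSne : S.Nonempty := by
    by_contra! hempty
    have hloc : IsLocallyConstant fun x => h x + x :=
      (IsLocallyConstant.iff_eventually_eq _).2 fun x => by
        simpa [hempty] using (hSmem x).not
    have := hloc.apply_eq_of_isPreconnected isPreconnected_univ (mem_univ (0 + 1)) (mem_univ 0)
    rw [hper] at this
    linarith
  obtain ⟨x₀, hx₀⟩ : ∃ x, x ∉ S := by
    by_contra! hall
    simp [eq_univ_of_forall hall] at hnull
  obtain ⟨V, hV, hVnn, hVS⟩ := exists_contDiff_zero_set_eq hSclosed hSper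
  have hVper : Function.Periodic (fun x : ℝ => V x) 1 := fun x => by simp
  obtain ⟨K, hK⟩ := exists_lipschitzWith_of_contDiff_of_periodic (hV.of_le (mod_cast le_top)) hVper
  obtain ⟨L, hL⟩ := exists_bound_of_continuous_of_periodic hV.continuous hVper
  obtain ⟨Ψ, hΨ⟩ := exists_isLineFlow hK hL
  obtain ⟨ψ, hflow, hcirc, hψ⟩ := hΨ.exists_circle_flow hK
  have hconst (t x : ℝ) : h (Ψ t x) + Ψ t x = h x + x :=
    hΨ.apply_eq_of_locallyConst hK (c := fun x => h x + x) (fun x hx => by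
      by_contra hx'
      exact hx ((hVS x).2 hx')) t x
  have hnn (x : ℝ) : 0 ≤ V x := hVnn x
  refine ⟨V, ψ, hV, hflow, hcirc, fun p ε hε T hT => ?_, hper.lift, ?_, fun t ht p => ?_,
    fun hfirst => ?_⟩
  · induction p using QuotientAddGroup.induction_on with
    | H x =>
      have := hΨ.hasStrongChain_add_one hK hVper hnn
        (by simpa only [hVS, ofPred_mem_eq] using hnull)
        (hSne.imp fun k hk => (hVS k).2 hk) x hε (by positivity : 0 < T + 1)
      simpa using (this.map unitAddCircle_dist_coe_le hψ).mono le_rfl (by linarith)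
  · exact (QuotientAddGroup.isQuotientMap_mk _).continuous_iff.2 hcont
  · induction p using QuotientAddGroup.induction_on with
    | H x =>
      rw [hψ]
      change h (Ψ t x) ≤ h x
      have := hΨ.monotone_time hnn x ht
      simp only [hΨ.zero] at this
      linarith [hconst t x]
  · have h1 := hfirst 1 (x₀ : UnitAddCircle)
    rw [hψ] at h1
    change h (Ψ 1 x₀) = h x₀ at h1
    have := hΨ.lt_apply hK hnn (x := x₀) (fun h0 => hx₀ ((hVS x₀).1 h0)) one_pos
    linarith [hconst 1 x₀]
end

section
/- Let φ : 𝕋 → [0,+∞) be a smooth non-negative function on the circle 𝕋 = ℝ/ℤ whose zero set K := φ^{-1}(0) has Lebesgue measure zero, and let ψ be the flow of the vector field V(x) = φ(x) ∂/∂x on 𝕋. Then every point of 𝕋 is strongly chain recurrent for ψ. -/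
open MeasureTheory

open Set

theorem HasStrongChain.mono_s18 {X : Type*} [MetricSpace X] {ψ : ℝ → X → X} {ε ε' T T' : ℝ} {a b : X}
    (h : HasStrongChain ψ ε T a b) (hε : ε ≤ ε') (hT : T' ≤ T) : HasStrongChain ψ ε' T' a b := by
  obtain ⟨n, x, t, hn, ht, h0, hl, hs⟩ := h
  exact ⟨n, x, t, hn, fun i => hT.trans (ht i), h0, hl, hs.trans_le hε⟩

theorem HasStrongChain.single_s18 {X : Type*} [MetricSpace X] {ψ : ℝ → X → X} {ε T t : ℝ} {a b : X}
    (ht : T ≤ t) (h : dist (ψ t a) b < ε) : HasStrongChain ψ ε T a b :=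
  ⟨1, ![a, b], ![t], one_pos, by simpa using ht, rfl, rfl, by simpa using h⟩

theorem HasStrongChain.cons {X : Type*} [MetricSpace X] {ψ : ℝ → X → X} {ε T t : ℝ} {a b c : X}
    (ht : T ≤ t) (h : HasStrongChain ψ ε T b c) :
    HasStrongChain ψ (dist (ψ t a) b + ε) T a c := by
  obtain ⟨n, x, s, hn, hs, rfl, hl, hsum⟩ := h
  refine ⟨n + 1, Fin.cons a x, Fin.cons t s, n.succ_pos, ?_, rfl, ?_, ?_⟩
  · exact Fin.cases ht hs
  · rw [← Fin.succ_last, Fin.cons_succ, hl]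
  · rw [Fin.sum_univ_succ]
    simpa [← Fin.succ_castSucc] using hsum

theorem UnitAddCircle.dist_coe_le (a b : ℝ) : dist (a : UnitAddCircle) b ≤ |a - b| := by
  rw [dist_eq_norm, ← AddCircle.coe_sub]
  exact QuotientAddGroup.norm_mk_le_norm

/-- A continuous-in-time lift of a flow on the circle is itself an action of time. -/
theorem lift_add_of_isFlow {ψ : ℝ → UnitAddCircle → UnitAddCircle} (hflow : IsFlow ψ)
    {Ψ : ℝ → ℝ → ℝ} (h0 : ∀ x, Ψ 0 x = x) (hcont : ∀ x, Continuous fun t => Ψ t x)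
    (hlift : ∀ t x : ℝ, ψ t (x : UnitAddCircle) = (Ψ t x : UnitAddCircle)) (t s x : ℝ) :
    Ψ t (Ψ s x) = Ψ (t + s) x := by
  refine congrFun ((AddCircle.isCoveringMap_coe (1 : ℝ)).eq_of_comp_eq
    (g₁ := fun t => Ψ t (Ψ s x)) (g₂ := fun t => Ψ (t + s) x) (hcont _)
    ((hcont x).comp (continuous_add_const s)) ?_ 0 (by simp [h0])) t
  funext t
  change ((Ψ t (Ψ s x) : ℝ) : UnitAddCircle) = (Ψ (t + s) x : ℝ)
  rw [← hlift, ← hlift, ← hlift, hflow.2.2]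

/-- Jumping over gaps contained in `U` and flowing elsewhere, one goes from `y` to `b` at a total
cost of at most the measure of `U` between the first landing point and `b`. -/
theorem hasStrongChain_of_progress {ψ : ℝ → UnitAddCircle → UnitAddCircle} {Ψ : ℝ → ℝ → ℝ}
    (h0 : ∀ x, Ψ 0 x = x) (hadd : ∀ t s x, Ψ t (Ψ s x) = Ψ (t + s) x)
    (hcont : ∀ x, Continuous fun t => Ψ t x) (hmono : ∀ x, Monotone fun t => Ψ t x)
    (hlift : ∀ t x : ℝ, ψ t (x : UnitAddCircle) = (Ψ t x : UnitAddCircle))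
    {U : Set ℝ} (hU : IsOpen U) {a b τ δ : ℝ} (hτ : 0 ≤ τ) (hδ : 0 < δ)
    (hprog : ∀ y ∈ Icc a b \ U, y + δ ≤ Ψ τ y) (n : ℕ) :
    ∀ y, a ≤ Ψ τ y → Ψ τ y ≤ b → b - Ψ τ y ≤ n * δ →
      ∀ ε, volume.real (U ∩ Icc (Ψ τ y) b) < ε → HasStrongChain ψ ε τ (y : UnitAddCircle) b := by
  have hfin : ∀ c d, volume (U ∩ Icc c d) ≠ ⊤ := fun c d =>
    ((measure_mono inter_subset_right).trans_lt measure_Icc_lt_top).ne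
  have hgap : ∀ c d e, c ≤ d → d ≤ e → Ico c d ⊆ U → d - c ≤ volume.real (U ∩ Icc c e) := by
    intro c d e hcd hde hs
    rw [← Real.volume_real_Ico_of_le hcd]
    exact measureReal_mono
      (subset_inter hs (Ico_subset_Icc_self.trans (Icc_subset_Icc_right hde))) (hfin _ _)
  induction n with
  | zero =>
    intro y _ h2 h3 ε hε
    have hb : Ψ τ y = b := by
      simp only [CharP.cast_eq_zero, zero_mul] at h3
      linarith
    refine HasStrongChain.single_s18 le_rfl ?_
    rw [hlift, hb, dist_self]
    exact measureReal_nonneg.trans_lt hε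
  | succ n ih =>
    intro y h1 h2 h3 ε hε
    set z := Ψ τ y with hz
    by_cases hzb : Icc z b ⊆ U
    · refine HasStrongChain.single_s18 le_rfl ?_
      rw [hlift]
      have := UnitAddCircle.dist_coe_le z b
      rw [abs_sub_comm, abs_of_nonneg (sub_nonneg.2 h2)] at this
      linarith [hgap z b b h2 le_rfl (Ico_subset_Icc_self.trans hzb)]
    · obtain ⟨p, hp, hpU⟩ := not_subset.1 hzb
      obtain ⟨y₁, ⟨hy₁, hy₁U⟩, hmin⟩ :=
        (isCompact_Icc.diff hU).exists_isLeast (s := Icc z b \ U) ⟨p, hp, hpU⟩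
      have hsub : Ico z y₁ ⊆ U := by
        intro w hw
        by_contra hwU
        exact hw.2.not_ge (hmin ⟨⟨hw.1, hw.2.le.trans hy₁.2⟩, hwU⟩)
      have hδ₁ := hprog y₁ ⟨⟨h1.trans hy₁.1, hy₁.2⟩, hy₁U⟩
      have hdist : ∀ w, z ≤ w → dist (ψ τ (y : UnitAddCircle)) w ≤ w - z := by
        intro w hw
        rw [hlift, ← abs_of_nonneg (sub_nonneg.2 hw), abs_sub_comm]
        exact UnitAddCircle.dist_coe_le z w
      rcases le_or_gt (Ψ τ y₁) b with hle | hgt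
      · have hsplit : (y₁ - z) + volume.real (U ∩ Icc (Ψ τ y₁) b) ≤ volume.real (U ∩ Icc z b) := by
          rw [← Real.volume_real_Ico_of_le hy₁.1, ← measureReal_union _
            (hU.measurableSet.inter measurableSet_Icc) _ (hfin _ _)]
          · refine measureReal_mono (union_subset (subset_inter hsub ?_)
              (inter_subset_inter_right _ (Icc_subset_Icc_left ?_))) (hfin _ _)
            · exact Ico_subset_Icc_self.trans (Icc_subset_Icc_right hy₁.2)
            · linarith [hy₁.1]
          · refine disjoint_left.2 fun w hw hw' => ?_
            have := hw'.2.1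
            linarith [hw.2]
          · exact measure_Ico_lt_top.ne
        have hrec := ih y₁ (by linarith [hy₁.1]) hle
          (by push_cast at h3; linarith [hy₁.1]) (ε - (y₁ - z)) (by linarith)
        exact (HasStrongChain.cons le_rfl hrec).mono_s18 (by linarith [hdist y₁ hy₁.1]) le_rfl
      · obtain ⟨s, hs, hsb⟩ := intermediate_value_Icc hτ (hcont y₁).continuousOn
          ⟨(h0 y₁).trans_le hy₁.2, hgt.le⟩
        simp only at hsb
        have hw : Ψ (s - τ) y₁ ≤ y₁ := by
          simpa [h0] using hmono y₁ (show s - τ ≤ 0 by linarith [hs.2])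
        rcases le_or_gt z (Ψ (s - τ) y₁) with hzw | hwz
        · have hlast : HasStrongChain ψ (ε - (Ψ (s - τ) y₁ - z)) τ
              ((Ψ (s - τ) y₁ : ℝ) : UnitAddCircle) b := by
            refine HasStrongChain.single_s18 le_rfl ?_
            rw [hlift, hadd, add_sub_cancel, hsb, dist_self]
            linarith [hgap z _ b hzw (hw.trans hy₁.2) ((Ico_subset_Ico_right hw).trans hsub)]
          exact (HasStrongChain.cons le_rfl hlast).mono_s18 (by linarith [hdist _ hzw]) le_rfl
        · obtain ⟨r, hr, hrz⟩ := intermediate_value_Icc (show s - τ ≤ 0 by linarith [hs.2])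
            (hcont y₁).continuousOn ⟨hwz.le, hy₁.1.trans_eq (h0 y₁).symm⟩
          simp only at hrz
          refine HasStrongChain.single_s18 (t := s - r + τ) (by linarith [hs.1, hr.2]) ?_
          rw [hlift, ← hadd, ← hz, ← hrz, hadd, sub_add_cancel, hsb, dist_self]
          exact measureReal_nonneg.trans_lt hε

/-- On a compact set where `f` is positive, solutions of `x' = f x` with `f ≥ 0` advance uniformly
in a given positive time. -/
theorem exists_uniform_progress {f : ℝ → ℝ} (hf : Continuous f) (hnonneg : ∀ x, 0 ≤ f x)
    {Ψ : ℝ → ℝ → ℝ} (h0 : ∀ x, Ψ 0 x = x)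
    (hderiv : ∀ x t, HasDerivAt (fun s => Ψ s x) (f (Ψ t x)) t)
    {K : Set ℝ} (hK : IsCompact K) (hpos : ∀ x ∈ K, 0 < f x) {τ : ℝ} (hτ : 0 < τ) :
    ∃ δ > 0, ∀ y ∈ K, y + δ ≤ Ψ τ y := by
  obtain ⟨m, hm, hmK⟩ := hK.exists_forall_le' hf.continuousOn hpos
  obtain ⟨η, hη, hηK⟩ := Metric.mem_uniformity_dist.1
    (hK.uniformContinuousAt_of_continuousAt f (fun _ _ => hf.continuousAt)
      (Metric.dist_mem_uniformity (half_pos hm)))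
  refine ⟨min η (m / 2 * τ), by positivity, fun y hy => ?_⟩
  by_contra! hlt
  have hmono : Monotone fun t => Ψ t y :=
    monotone_of_deriv_nonneg (fun t => (hderiv y t).differentiableAt)
      fun t => (hderiv y t).deriv ▸ hnonneg _
  have hspeed : ∀ t ∈ interior (Icc 0 τ), m / 2 ≤ deriv (fun s => Ψ s y) t := by
    intro t ht
    replace ht := interior_subset ht
    have h₁ : y ≤ Ψ t y := by simpa [h0] using hmono ht.1
    have h₂ : Ψ t y ≤ Ψ τ y := hmono ht.2
    have hclose : dist y (Ψ t y) < η := by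
      rw [dist_comm, Real.dist_eq, abs_of_nonneg (sub_nonneg.2 h₁)]
      linarith [min_le_left η (m / 2 * τ)]
    have h := hηK hclose hy
    rw [mem_ofPred_eq, Real.dist_eq] at h
    rw [(hderiv y t).deriv]
    linarith [(abs_lt.1 h).2, hmK y hy]
  have h := (convex_Icc 0 τ).mul_sub_le_image_sub_of_le_deriv
    (fun t _ => (hderiv y t).continuousAt.continuousWithinAt)
    (fun t _ => (hderiv y t).differentiableAt.differentiableWithinAt) hspeed
    0 (left_mem_Icc.2 hτ.le) τ (right_mem_Icc.2 hτ.le) hτ.le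
  rw [h0, sub_zero] at h
  linarith [min_le_right η (m / 2 * τ)]

theorem SCR_of_nonneg_field_with_null_zero_set
    (φ : UnitAddCircle → ℝ) (hsmooth : ContDiff ℝ (⊤ : ℕ∞) (fun x : ℝ => φ x))
    (hnonneg : ∀ p, 0 ≤ φ p)
    (hnull : volume {p : UnitAddCircle | φ p = 0} = 0)
    (ψ : ℝ → UnitAddCircle → UnitAddCircle)
    (hflow : IsFlow ψ) (hflowof : IsCircleFlowOf φ ψ) :
    ∀ p : UnitAddCircle, StronglyChainRecurrentPt ψ p := by
  obtain ⟨Ψ, h0, hderiv, hlift⟩ := hflowof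
  have hcont : ∀ x, Continuous fun t => Ψ t x := fun x =>
    continuous_iff_continuousAt.2 fun t => (hderiv x t).continuousAt
  have hmono : ∀ x, Monotone fun t => Ψ t x := fun x =>
    monotone_of_deriv_nonneg (fun t => (hderiv x t).differentiableAt)
      fun t => (hderiv x t).deriv ▸ hnonneg _
  have hadd := lift_add_of_isFlow hflow h0 hcont hlift
  have hZ : volume {x : ℝ | φ x = 0} = 0 := by
    rw [← inter_univ {x : ℝ | φ x = 0}, ← iUnion_Ioc_intCast, inter_iUnion, measure_iUnion_null_iff]
    intro n
    have h := (AddCircle.measurePreserving_mk 1 (n : ℝ)).quasiMeasurePreserving.preimage_null hnull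
    rwa [Measure.restrict_apply' measurableSet_Ioc] at h
  intro p ε hε T hT
  obtain ⟨x, rfl⟩ := QuotientAddGroup.mk_surjective p
  have hτ : 0 < T + 1 := by linarith
  obtain ⟨U, hZU, hU, hUε⟩ := {x : ℝ | φ x = 0}.exists_isOpen_lt_of_lt (ENNReal.ofReal ε)
    (hZ.trans_lt (ENNReal.ofReal_pos.2 hε))
  have hx : x ≤ Ψ (T + 1) x := by simpa [h0] using hmono x hτ.le
  obtain ⟨N, hN⟩ := exists_nat_ge (Ψ (T + 1) x - x)
  obtain ⟨δ, hδ, hprog⟩ := exists_uniform_progress hsmooth.continuous (fun y => hnonneg y) h0 hderiv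
    ((isCompact_Icc (a := x) (b := x + N)).diff hU)
    (fun y hy => (hnonneg y).lt_of_ne' fun h => hy.2 (hZU h)) hτ
  obtain ⟨n, hn⟩ := exists_nat_ge ((x + N - Ψ (T + 1) x) / δ)
  have hchain := hasStrongChain_of_progress h0 hadd hcont hmono hlift hU hτ.le hδ hprog n x hx
    (by linarith) ((div_le_iff₀ hδ).1 hn) ε ((measureReal_mono inter_subset_left
      hUε.ne_top).trans_lt ((ENNReal.lt_ofReal_iff_toReal_lt hUε.ne_top).1 hUε))
  have hxN : ((x + N : ℝ) : UnitAddCircle) = x := by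
    rw [AddCircle.coe_add, ← nsmul_one, AddCircle.coe_nsmul, AddCircle.coe_period, smul_zero,
      add_zero]
  rw [hxN] at hchain
  exact hchain.mono_s18 le_rfl (by linarith)
end

section
/- Let φ : 𝕋 → [0,+∞) be a smooth non-negative function on the circle 𝕋 = ℝ/ℤ whose zero set K := φ^{-1}(0) has empty interior, and let ψ be the flow of the vector field V(x) = φ(x) ∂/∂x on 𝕋. Then every C¹ Lyapunov function h : 𝕋 → ℝ for ψ is constant (in particular, it is a first integral). -/
open MeasureTheory

/-- A function that does not exceed its value at `a` to the right of `a` has nonpositive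
derivative there. -/
theorem HasDerivAt.nonpos_of_forall_ge_le {f : ℝ → ℝ} {f' a : ℝ} (hf : HasDerivAt f f' a)
    (hle : ∀ s, a ≤ s → f s ≤ f a) : f' ≤ 0 := by
  have hlim : Filter.Tendsto (slope f a) (nhdsWithin a (Set.Ioi a)) (nhds f') :=
    (hasDerivWithinAt_iff_tendsto_slope' Set.self_notMem_Ioi).1 hf.hasDerivWithinAt
  refine le_of_tendsto hlim ?_
  filter_upwards [self_mem_nhdsWithin] with s hs
  rw [slope_def_field]
  exact div_nonpos_of_nonpos_of_nonneg (sub_nonpos.2 (hle s (le_of_lt hs)))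
    (sub_nonneg.2 (le_of_lt hs))

/-- A function on the circle with antitone lift to the line is constant. -/
theorem UnitAddCircle.eq_of_antitone_lift {h : UnitAddCircle → ℝ}
    (hanti : Antitone (fun x : ℝ => h x)) (p q : UnitAddCircle) : h p = h q := by
  suffices hle : ∀ p q : UnitAddCircle, h q ≤ h p from le_antisymm (hle q p) (hle p q)
  intro p q
  induction p using QuotientAddGroup.induction_on with | H x => ?_
  induction q using QuotientAddGroup.induction_on with | H y => ?_
  obtain ⟨n, hn⟩ := exists_nat_ge (x - y)
  have hxy : h ((y + n : ℝ) : UnitAddCircle) ≤ h (x : UnitAddCircle) :=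
    hanti (by linarith : x ≤ y + n)
  have hper : ((y + n : ℝ) : UnitAddCircle) = (y : UnitAddCircle) := by
    have := (AddCircle.coe_period (1 : ℝ))
    rw [AddCircle.coe_add, ← nsmul_one, AddCircle.coe_nsmul, this, smul_zero, add_zero]
  rwa [hper] at hxy

/-- The infinitesimal form of the Lyapunov inequality on the circle. -/
theorem IsLyapunov.deriv_mul_nonpos {φ h : UnitAddCircle → ℝ}
    {ψ : ℝ → UnitAddCircle → UnitAddCircle} (hLyap : IsLyapunov ψ h)
    (hflowof : IsCircleFlowOf φ ψ) {x : ℝ} (hdiff : DifferentiableAt ℝ (fun x : ℝ => h x) x) :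
    deriv (fun x : ℝ => h x) x * φ x ≤ 0 := by
  obtain ⟨Ψ, hΨ0, hΨ, hψ⟩ := hflowof
  have hx := hΨ x 0
  rw [hΨ0] at hx
  have hcomp : HasDerivAt (fun s => h (Ψ s x)) (deriv (fun x : ℝ => h x) x * φ x) 0 :=
    HasDerivAt.comp_of_eq 0 hdiff.hasDerivAt hx (hΨ0 x).symm
  refine hcomp.nonpos_of_forall_ge_le fun s hs => ?_
  rw [hΨ0, ← hψ]
  exact hLyap s hs x

theorem C1_lyapunov_constant_of_nonneg_field_with_nowhere_dense_zero_set
    (φ : UnitAddCircle → ℝ) (hsmooth : ContDiff ℝ (⊤ : ℕ∞) (fun x : ℝ => φ x))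
    (hnonneg : ∀ p, 0 ≤ φ p)
    (hint : interior {p : UnitAddCircle | φ p = 0} = ∅)
    (ψ : ℝ → UnitAddCircle → UnitAddCircle)
    (hflow : IsFlow ψ) (hflowof : IsCircleFlowOf φ ψ)
    (h : UnitAddCircle → ℝ) (hC1 : ContDiff ℝ 1 (fun x : ℝ => h x))
    (hLyap : IsLyapunov ψ h) :
    (∀ p q : UnitAddCircle, h p = h q) ∧ IsFirstIntegral ψ h := by
  have hdense : Dense {x : ℝ | φ x ≠ 0} :=
    (interior_eq_empty_iff_dense_compl.1 hint).preimage QuotientAddGroup.isOpenMap_coe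
  have hderiv : ∀ x : ℝ, deriv (fun x : ℝ => h x) x ≤ 0 := by
    have hclosed : IsClosed {x : ℝ | deriv (fun x : ℝ => h x) x ≤ 0} :=
      isClosed_le hC1.continuous_deriv_one continuous_const
    intro x
    refine hclosed.closure_subset_iff.2 (fun y hy => ?_) (hdense x)
    exact nonpos_of_mul_nonpos_left
      (hLyap.deriv_mul_nonpos hflowof (hC1.differentiable one_ne_zero y))
      ((hnonneg y).lt_of_ne' hy)
  have hconst := UnitAddCircle.eq_of_antitone_lift
    (antitone_of_deriv_nonpos (hC1.differentiable one_ne_zero) hderiv)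
  exact ⟨hconst, fun t x => hconst _ _⟩
end
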